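/- Let p and q be distinct odd primes, and let G be a finite group of minimal order with respect to the property that G contains an element whose order is divisible by p·q but every element of G \ Frat(G) has order divisible by some prime other than p and q (i.e., Ω_{p,q}(G) ≠ ∅ and Ω**_{p,q}(G) = ∅). Set X = G/Frat(G) and S = soc(X), the socle of X (the subgroup generated by the minimal normal subgroups of X). Then S is a nonabelian simple group, and S contains a Sylow p-subgroup of X and a Sylow q-subgroup of X. -/

import Mathlib

/-- `Ω_{p,q}(G) ≠ ∅` and `Ω**_{p,q}(G) = ∅`: `G` has an element of order divisible by
`p·q`, but every element of `G` whose order is divisible by `p·q` and by no prime other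
than `p` and `q` lies in the Frattini subgroup. -/
def OmegaBad (p q : ℕ) (G : Type*) [Group G] : Prop :=
  (∃ g : G, p * q ∣ orderOf g) ∧
    ∀ g : G, (p * q ∣ orderOf g ∧ ∀ r : ℕ, r.Prime → r ∣ orderOf g → r = p ∨ r = q) →
      g ∈ frattini G

/-- `N` is a minimal normal subgroup of `G`. -/
def IsMinimalNormal {G : Type*} [Group G] (N : Subgroup G) : Prop :=
  N.Normal ∧ N ≠ ⊥ ∧ ∀ M : Subgroup G, M.Normal → M ≤ N → M = ⊥ ∨ M = N

/-- The socle of a group: the subgroup generated by all minimal normal subgroups. -/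
def socle (X : Type*) [Group X] : Subgroup X :=
  ⨆ N ∈ {N : Subgroup X | IsMinimalNormal N}, N

theorem prod_range_pow_eq_one_of_fixedPointFree {E V : Type*} [Group E] [CommGroup V]
    (ρ : E →* MulAut V) {p : ℕ} {x : E} (hx : x ^ p = 1)
    (hfix : ∀ v, ρ x v = v → v = 1) (v : V) :
    ∏ j ∈ Finset.range p, ρ (x ^ j) v = 1 := by
  apply hfix
  rw [map_prod]
  have h : ∀ j ∈ Finset.range p, ρ x (ρ (x ^ j) v) = ρ (x ^ (j + 1)) v := by
    intro j _
    rw [pow_succ', map_mul, MulAut.mul_apply]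
  rw [Finset.prod_congr rfl h]
  have h1 := Finset.prod_range_succ (fun j => ρ (x ^ j) v) p
  have h2 := Finset.prod_range_succ' (fun j => ρ (x ^ j) v) p
  rw [h1] at h2
  simpa [hx] using h2.symm

/-- If `a` and `b` commute, have `p`-th powers trivial, and generate a group acting on an abelian
group `V` such that `a` and all `b * a ^ i` fix no nontrivial element, then `V` has exponent
dividing `p`. -/
theorem pow_eq_one_of_fixedPointFree {E V : Type*} [Group E] [CommGroup V]
    (ρ : E →* MulAut V) {p : ℕ} (hp : p.Prime) {a b : E} (hab : Commute a b)
    (ha : a ^ p = 1) (hb : b ^ p = 1) (hfa : ∀ v, ρ a v = v → v = 1)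
    (hfb : ∀ i, ∀ v, ρ (b * a ^ i) v = v → v = 1) (v : V) : v ^ p = 1 := by
  have hN : ∀ i ∈ Finset.range p, ∏ j ∈ Finset.range p, ρ ((b * a ^ i) ^ j) v = 1 := by
    intro i _
    refine prod_range_pow_eq_one_of_fixedPointFree ρ ?_ (hfb i) v
    rw [(hab.symm.pow_right i).mul_pow, hb, ← pow_mul, mul_comm, pow_mul, ha, one_pow, one_mul]
  have hprod := Finset.prod_congr rfl hN
  rw [Finset.prod_const_one, Finset.prod_comm] at hprod
  have hj : ∀ j ∈ Finset.range p, j ≠ 0 →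
      ∏ i ∈ Finset.range p, ρ ((b * a ^ i) ^ j) v = 1 := by
    intro j hjp hj0
    have hfix : ∀ v, ρ (a ^ j) v = v → v = 1 := by
      intro w hw
      apply hfa
      have hcop : Nat.Coprime j p :=
        (Nat.coprime_of_lt_prime hj0 (Finset.mem_range.mp hjp) hp).symm
      obtain ⟨m, hm⟩ := exists_pow_eq_self_of_coprime (x := a)
        (hcop.coprime_dvd_right (orderOf_dvd_of_pow_eq_one ha))
      have : ∀ n : ℕ, ρ ((a ^ j) ^ n) w = w := by
        intro n
        induction n with
        | zero => simp
        | succ n ih => rw [pow_succ, map_mul, MulAut.mul_apply, hw, ih]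
      rw [← hm]
      exact this m
    have h := prod_range_pow_eq_one_of_fixedPointFree ρ (p := p) (x := a ^ j)
      (by rw [← pow_mul, mul_comm, pow_mul, ha, one_pow]) hfix v
    have h' : ∀ i ∈ Finset.range p, ρ ((b * a ^ i) ^ j) v = ρ (b ^ j) (ρ ((a ^ j) ^ i) v) := by
      intro i _
      rw [(hab.symm.pow_right i).mul_pow, map_mul, MulAut.mul_apply, ← pow_mul, ← pow_mul,
        mul_comm]
    rw [Finset.prod_congr rfl h', ← map_prod, h, map_one]
  rw [Finset.prod_eq_single_of_mem 0 (Finset.mem_range.mpr hp.pos) hj] at hprod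
  simpa using hprod

/-- For odd `p`, a finite `p`-group without a subgroup isomorphic to `ℤ/p × ℤ/p` is cyclic. -/
theorem IsPGroup.isCyclic_of_odd {p : ℕ} (hp : p.Prime) (hodd : Odd p) :
    ∀ {A : Type*} [Group A] [Finite A], IsPGroup p A →
      (∀ a b : A, a ^ p = 1 → b ^ p = 1 → a ≠ 1 → Commute a b → b ∈ Subgroup.zpowers a) →
      IsCyclic A := by
  intro A _ _
  induction hn : Nat.card A using Nat.strong_induction_on generalizing A with
  | _ n ih =>
  intro hA hrank
  have := Fact.mk hp
  by_contra hcyc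
  have hnt : Nontrivial A := by
    by_contra h
    rw [not_nontrivial_iff_subsingleton] at h
    exact hcyc inferInstance
  have hnil : Group.IsNilpotent A := hA.isNilpotent
  have hcoatom : ∀ a : A, ∃ M : Subgroup A, IsCoatom M ∧ a ∈ M := by
    intro a
    have hne : Subgroup.zpowers a ≠ ⊤ := fun h =>
      hcyc ⟨a, fun x => by
        have : x ∈ Subgroup.zpowers a := h ▸ Subgroup.mem_top x
        exact this⟩
    obtain ⟨M, hM, hle⟩ := (eq_top_or_exists_le_coatom (Subgroup.zpowers a)).resolve_left hne
    exact ⟨M, hM, hle (Subgroup.mem_zpowers a)⟩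
  have hnormal : ∀ M : Subgroup A, IsCoatom M → M.Normal := fun M hM =>
    Subgroup.NormalizerCondition.normal_of_coatom M Group.normalizerCondition_of_isNilpotent hM
  have hcard : ∀ M : Subgroup A, IsCoatom M → Nat.card A = p * Nat.card M := by
    intro M hM
    obtain ⟨k, hk⟩ := IsPGroup.iff_card.mp (hA.to_subgroup M)
    obtain ⟨m, hm⟩ := IsPGroup.iff_card.mp hA
    have hlt : p ^ k < p ^ m := by
      rw [← hk, ← hm]
      exact lt_of_le_of_ne M.card_le_card_group fun h => hM.1 (M.eq_top_of_card_eq h)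
    have hkm : k < m := (Nat.pow_lt_pow_iff_right hp.one_lt).mp hlt
    obtain ⟨K, hK, hMK⟩ := Sylow.exists_subgroup_card_pow_succ (p := p) (n := k)
      (hm ▸ pow_dvd_pow p hkm) hk
    have hne : M ≠ K := by
      rintro rfl
      rw [hk] at hK
      exact absurd (Nat.pow_right_injective hp.two_le hK) (by omega)
    rw [hM.2 K (lt_of_le_of_ne hMK hne), Subgroup.card_top] at hK
    rw [hK, hk, pow_succ']
  have hindex : ∀ M : Subgroup A, IsCoatom M → M.index = p := by
    intro M hM
    have h := M.card_mul_index
    rw [hcard M hM, mul_comm p] at h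
    exact Nat.eq_of_mul_eq_mul_left Nat.card_pos h
  have hMcyc : ∀ M : Subgroup A, IsCoatom M → IsCyclic M := by
    intro M hM
    refine ih (Nat.card M) ?_ rfl (hA.to_subgroup M) ?_
    · rw [← hn]
      exact lt_of_le_of_ne M.card_le_card_group fun h => hM.1 (M.eq_top_of_card_eq h)
    · intro a b ha hb hne hab
      obtain ⟨k, hk⟩ := hrank a b (by exact_mod_cast ha) (by exact_mod_cast hb)
        (by exact_mod_cast hne) (by simpa [Commute, SemiconjBy, Subtype.ext_iff] using hab)
      exact ⟨k, Subtype.ext (by simpa using hk)⟩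
  have hcentral : ∀ z ∈ frattini A, ∀ a : A, Commute z a := by
    intro z hz a
    obtain ⟨M, hM, ha⟩ := hcoatom a
    have := hMcyc M hM
    have hc := (IsCyclic.isMulCommutative (α := M)).is_comm.comm
      ⟨z, frattini_le_coatom hM hz⟩ ⟨a, ha⟩
    exact congrArg Subtype.val hc
  have hmemF : ∀ a : A, (∀ M : Subgroup A, IsCoatom M → a ∈ M) → a ∈ frattini A := by
    intro a h
    simp only [frattini, Order.radical, Subgroup.mem_iInf]
    exact fun M hM => h M hM
  have hpowM : ∀ M : Subgroup A, IsCoatom M → ∀ a : A, a ^ p ∈ M := by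
    intro M hM a
    have := hnormal M hM
    rw [← hindex M hM]
    exact Subgroup.pow_index_mem M a
  have hpow : ∀ a : A, a ^ p ∈ frattini A := fun a => hmemF _ fun M hM => hpowM M hM a
  have hcomm : ∀ a b : A, b⁻¹ * a⁻¹ * b * a ∈ frattini A := by
    intro a b
    refine hmemF _ fun M hM => ?_
    have := hnormal M hM
    have hcyc : IsCyclic (A ⧸ M) := isCyclic_of_prime_card (p := p) (hindex M hM)
    have hc := (IsCyclic.isMulCommutative (α := A ⧸ M)).is_comm.comm (a : A ⧸ M) b
    rw [← QuotientGroup.eq_one_iff]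
    simp only [QuotientGroup.mk_mul, QuotientGroup.mk_inv]
    rw [mul_assoc, ← hc]
    group
  have hmul : ∀ a b : A, (a * b) ^ p = a ^ p * b ^ p := by
    intro a b
    obtain ⟨c, hc⟩ : ∃ c, c = b⁻¹ * a⁻¹ * b * a := ⟨_, rfl⟩
    have hcz : ∀ x, Commute c x := hcentral c (hc ▸ hcomm a b)
    have hba : b * a = a * b * c := by rw [hc]; group
    have hbn : ∀ n : ℕ, b ^ n * a = a * b ^ n * c ^ n := by
      intro n
      induction n with
      | zero => simp
      | succ n ihn =>
        rw [pow_succ', mul_assoc, ihn, ← mul_assoc, ← mul_assoc, hba, mul_assoc (a * b) c,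
          ((hcz (b ^ n)).eq), pow_succ' c]
        simp only [mul_assoc]
    have hcp : c ^ p = 1 := by
      have h := hbn p
      rw [(hcentral _ (hpow b) a).eq] at h
      exact (mul_eq_left.mp h.symm)
    have hn : ∀ n : ℕ, (a * b) ^ n = a ^ n * b ^ n * c ^ (n * (n - 1) / 2) := by
      intro n
      induction n with
      | zero => simp
      | succ n ihn =>
        have he : (n + 1) * (n + 1 - 1) / 2 = n * (n - 1) / 2 + n := by
          rw [← Finset.sum_range_id_mul_two, ← Finset.sum_range_id_mul_two,
            Nat.mul_div_cancel _ two_pos, Nat.mul_div_cancel _ two_pos, Finset.sum_range_succ]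
        rw [pow_succ, ihn, he, mul_assoc, ((hcz (a * b)).pow_left _).eq, ← mul_assoc,
          mul_assoc (a ^ n), ← mul_assoc (b ^ n), hbn n, mul_assoc _ (c ^ n),
          ((hcz b).pow_left n).eq, pow_succ a, pow_succ b, add_comm, pow_add]
        simp only [mul_assoc]
    obtain ⟨k, hk⟩ := hodd
    have he : p * (p - 1) / 2 = p * k := by
      have : p - 1 = k * 2 := by omega
      rw [this, ← mul_assoc, Nat.mul_div_cancel _ two_pos]
    rw [hn p, he, pow_mul, hcp, one_pow, mul_one]
  let f : A →* A := MonoidHom.mk' (fun a => a ^ p) hmul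
  obtain ⟨M, hM, -⟩ := hcoatom 1
  have hker : Nat.card f.ker ≤ p := by
    have := hA.center_nontrivial
    obtain ⟨z, hz, hzp⟩ : ∃ z : Subgroup.center A, z ≠ 1 ∧ z ^ p = 1 := by
      have hd : p ∣ Nat.card (Subgroup.center A) :=
        ((hA.to_subgroup _).card_eq_or_dvd).resolve_left
          (Finite.one_lt_card_iff_nontrivial.mpr this).ne'
      obtain ⟨z, hz⟩ := exists_prime_orderOf_dvd_card' p hd
      refine ⟨z, ?_, hz ▸ pow_orderOf_eq_one z⟩
      rintro rfl
      exact hp.one_lt.ne (by simpa using hz)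
    have hle : f.ker ≤ Subgroup.zpowers (z : A) := fun b hb =>
      hrank z b (by exact_mod_cast hzp) hb (by exact_mod_cast hz)
        ((Subgroup.mem_center_iff.mp z.2 b).symm)
    calc Nat.card f.ker ≤ Nat.card (Subgroup.zpowers (z : A)) :=
          Nat.le_of_dvd Nat.card_pos (Subgroup.card_dvd_of_le hle)
      _ = orderOf (z : A) := Nat.card_zpowers _
      _ ≤ p := Nat.le_of_dvd hp.pos (orderOf_dvd_of_pow_eq_one (by exact_mod_cast hzp))
  have hrange : f.range = M := by
    refine Subgroup.eq_of_le_of_card_ge ?_ ?_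
    · rintro _ ⟨a, rfl⟩
      exact hpowM M hM a
    · have h1 := f.ker.card_mul_index
      rw [Subgroup.index_ker, hcard M hM] at h1
      by_contra! hlt
      have := Nat.mul_lt_mul_of_le_of_lt hker hlt hp.pos
      omega
  obtain ⟨⟨x, hxM⟩, hx⟩ := (hMcyc M hM).exists_generator
  obtain ⟨a, ha⟩ : ∃ a, a ^ p = x := by
    rw [← hrange] at hxM
    exact hxM
  have hox : orderOf x = Nat.card M := by
    rw [← Subgroup.orderOf_mk x hxM]
    exact orderOf_eq_card_of_forall_mem_zpowers hx
  by_cases hM1 : Nat.card M = 1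
  · exact hcyc (isCyclic_of_prime_card (p := p) (by rw [hcard M hM, hM1, mul_one]))
  · refine hcyc (isCyclic_of_orderOf_eq_card a ?_)
    have hpo : p ∣ orderOf a := by
      refine hA.dvd_orderOf ?_
      rintro rfl
      rw [one_pow] at ha
      rw [← ha, orderOf_one] at hox
      exact hM1 hox.symm
    rw [hcard M hM, ← hox, ← ha, orderOf_pow_of_dvd hp.ne_zero hpo, Nat.mul_div_cancel' hpo]

open MulAction Pointwise in
theorem Subgroup.IsComplement'.exists_map_conj_eq_of_coprime {G : Type*} [Group G] [Finite G]
    {H : Subgroup G} [H.Normal] [IsMulCommutative H] (hH : Nat.Coprime (Nat.card H) H.index)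
    {K L : Subgroup G} (hK : Subgroup.IsComplement' H K) (hL : Subgroup.IsComplement' H L) :
    ∃ h ∈ H, K.map (MulAut.conj h).toMonoidHom = L := by
  have hstab : ∀ K : Subgroup G, Subgroup.IsComplement' H K →
      ∃ α : H.QuotientDiff, stabilizer G α = K := by
    intro K hK
    let S : H.LeftTransversal := ⟨(K : Set G), hK.symm⟩
    let α : H.QuotientDiff := Quotient.mk'' S
    refine ⟨α, (Subgroup.eq_of_le_of_card_ge ?_ ?_).symm⟩
    · intro k hk
      rw [mem_stabilizer_iff]
      change Quotient.mk'' (MulOpposite.op k⁻¹ • S) = Quotient.mk'' S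
      congr 1
      apply Subtype.ext
      change MulOpposite.op k⁻¹ • (K : Set G) = K
      exact op_smul_coe_set (K.inv_mem hk)
    · have h1 := (Subgroup.isComplement'_stabilizer_of_coprime (α := α) hH).card_mul_card
      have h2 := hK.card_mul_card
      exact (Nat.eq_of_mul_eq_mul_left Nat.card_pos (h1.trans h2.symm)).le
  obtain ⟨α, hα⟩ := hstab K hK
  obtain ⟨β, hβ⟩ := hstab L hL
  obtain ⟨h, hh⟩ := Subgroup.exists_smul_eq hH α β
  refine ⟨h, h.2, ?_⟩
  rw [← hα, ← hβ, ← hh]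
  exact (stabilizer_smul_eq_stabilizer_map_conj (h : G) α).symm

/-- A normal abelian Hall subgroup `Q` of `M ⊴ G` lying in the Frattini subgroup of `G` has
a complement in `M` which is normal in `G`. -/
theorem exists_normal_complement_of_le_frattini {G : Type*} [Group G] [Finite G]
    {Q M : Subgroup G} [Q.Normal] [M.Normal] [IsMulCommutative Q] (hQM : Q ≤ M)
    (hQ : Q ≤ frattini G) (hcop : Nat.Coprime (Nat.card Q) (Q.relIndex M)) :
    ∃ L : Subgroup G, L.Normal ∧ L ≤ M ∧ Nat.card L = Q.relIndex M := by
  let H : Subgroup M := Q.subgroupOf M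
  have : IsMulCommutative H := by
    refine ⟨⟨fun a b => ?_⟩⟩
    have := congrArg Subtype.val
      ((inferInstance : IsMulCommutative Q).is_comm.comm ⟨a.1.1, a.2⟩ ⟨b.1.1, b.2⟩)
    exact Subtype.ext (Subtype.ext this)
  have hHcard : Nat.card H = Nat.card Q := Nat.card_congr (Subgroup.subgroupOfEquivOfLe hQM).toEquiv
  have hHcop : Nat.Coprime (Nat.card H) H.index := hHcard ▸ hcop
  obtain ⟨K, hK⟩ := Subgroup.exists_right_complement'_of_coprime hHcop
  have hKcard : Nat.card K = H.index := by
    have h1 := hK.card_mul_card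
    rw [← H.card_mul_index] at h1
    exact Nat.eq_of_mul_eq_mul_left Nat.card_pos h1
  refine ⟨K.map M.subtype, ?_, Subgroup.map_subtype_le K, ?_⟩
  · rw [← Subgroup.normalizer_eq_top_iff]
    apply frattini_nongenerating
    rw [eq_top_iff]
    intro g _
    have hK' : Subgroup.IsComplement' H (K.map (MulAut.conjNormal g : MulAut M).toMonoidHom) := by
      have hc : Nat.card (K.map (MulAut.conjNormal g : MulAut M).toMonoidHom) = Nat.card K :=
        Subgroup.card_map_of_injective (MulAut.conjNormal g : MulAut M).injective
      apply Subgroup.isComplement'_of_coprime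
      · rw [hc, hK.card_mul_card]
      · rw [hc, hKcard]; exact hHcop
    obtain ⟨h, hh, hconj⟩ := hK'.exists_map_conj_eq_of_coprime hHcop hK
    have hmem : (h : G) * g ∈ Subgroup.normalizer ((K.map M.subtype : Subgroup G) : Set G) := by
      rw [Subgroup.mem_normalizer_iff_map_conj_eq]
      nth_rewrite 2 [← hconj]
      simp only [Subgroup.map_map]
      congr 1
      ext x
      simp [mul_assoc]
    have : g = (h : G)⁻¹ * (h * g) := by group
    rw [this, sup_comm]
    exact Subgroup.mul_mem_sup (hQ (Q.inv_mem hh)) hmem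
  · rw [Subgroup.card_map_of_injective M.subtype_injective, hKcard]
    rfl

open Pointwise in
theorem sylow_le_of_isSimpleGroup {X : Type*} [Group X] [Finite X] {p : ℕ} [Fact p.Prime]
    (T : Subgroup X) [T.Normal] [IsSimpleGroup T] (hT : ¬ ∀ a b : T, a * b = b * a)
    (hpT : p ∣ Nat.card T) (A : Sylow p X) (hA : IsCyclic A) : (A : Subgroup X) ≤ T := by
  let Y : Subgroup X := T ⊔ A
  let B : Sylow p Y := A.subtype le_sup_right
  have : IsCyclic B :=
    isCyclic_of_surjective _ (Subgroup.subgroupOfEquivOfLe (le_sup_right : ↑A ≤ Y)).symm.surjective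
  let U : Subgroup Y := T.subgroupOf Y
  let e : U ≃* T := Subgroup.subgroupOfEquivOfLe (le_sup_left : T ≤ Y)
  rcases B.normalizer_le_centralizer_or_le_commutator with h | h
  · exfalso
    let f := MonoidHom.transferSylow B h
    let g : T →* B := f.comp (Subgroup.inclusion le_sup_left)
    rcases (inferInstance : g.ker.Normal).eq_bot_or_eq_top with hk | hk
    · apply hT
      intro a b
      apply (MonoidHom.ker_eq_bot_iff g).mp hk
      rw [map_mul, map_mul]
      exact (IsCyclic.isMulCommutative (α := B)).is_comm.comm _ _
    · obtain ⟨t, ht⟩ := exists_prime_orderOf_dvd_card' p hpT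
      have ht' : Subgroup.inclusion (le_sup_left : T ≤ Y) t ∈ f.ker := by
        have : t ∈ g.ker := hk ▸ Subgroup.mem_top t
        exact this
      apply MonoidHom.not_dvd_card_ker_transferSylow B h
      have h1 := Subgroup.orderOf_dvd_natCard _ ht'
      rwa [orderOf_injective _ (Subgroup.inclusion_injective (le_sup_left : T ≤ Y)) t, ht] at h1
  · have hU : commutator Y ≤ U := by
      have hsurj : Function.Surjective
          ((QuotientGroup.mk' U).comp (Subgroup.inclusion (le_sup_right : ↑A ≤ Y))) := by
        intro y
        obtain ⟨⟨y, hy⟩, rfl⟩ := QuotientGroup.mk'_surjective U y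
        have hy' : y ∈ (T : Set X) * ((A : Subgroup X) : Set X) := by
          rw [← Subgroup.normal_mul]
          exact hy
        obtain ⟨t, ht, a, ha, hta⟩ := hy'
        subst hta
        refine ⟨⟨a, ha⟩, ?_⟩
        refine QuotientGroup.eq.mpr (Subgroup.mem_subgroupOf.mpr ?_)
        have := ‹T.Normal›.conj_mem t ht a⁻¹
        simpa [mul_assoc] using this
      have := isCyclic_of_surjective _ hsurj
      rw [← Subgroup.Normal.quotient_commutative_iff_commutator_le]
      exact IsCyclic.isMulCommutative (α := Y ⧸ U)
    intro a ha
    exact hU (h (show (⟨a, (le_sup_right : ↑A ≤ Y) ha⟩ : Y) ∈ (B : Subgroup Y) from ha))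

/-- A normal `n`-subgroup of `T ⊴ X` lies in an `n`-subgroup of `T` which is normal in `X`. -/
theorem exists_normal_isPGroup {X : Type*} [Group X] [Finite X] {T : Subgroup X} [T.Normal]
    {n : ℕ} (D : Subgroup T) [D.Normal] (hD : IsPGroup n D) :
    ∃ N : Subgroup X, N.Normal ∧ N ≤ T ∧ D.map T.subtype ≤ N ∧ IsPGroup n N := by
  let E : X → Subgroup T := fun x => D.map (MulAut.conjNormal x : MulAut T).toMonoidHom
  have hE : ∀ x, (E x).Normal := fun x =>
    ‹D.Normal›.map _ (MulAut.conjNormal x : MulAut T).surjective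
  refine ⟨(⨆ x, E x).map T.subtype, ⟨?_⟩, Subgroup.map_subtype_le _, ?_, ?_⟩
  · rintro _ ⟨t, ht, rfl⟩ g
    refine ⟨MulAut.conjNormal g t, ?_, by simp⟩
    have : (⨆ x, E x).map (MulAut.conjNormal g : MulAut T).toMonoidHom ≤ ⨆ x, E x := by
      rw [Subgroup.map_iSup]
      refine iSup_le fun x => ?_
      refine le_trans (le_of_eq ?_) (le_iSup E (g * x))
      simp only [E, Subgroup.map_map, map_mul]
      rfl
    exact this ⟨t, ht, rfl⟩
  · refine Subgroup.map_mono (le_trans (le_of_eq ?_) (le_iSup E 1))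
    simp only [E, map_one]
    exact (Subgroup.map_id D).symm
  · exact (Sylow.iSup_of_normal E fun x => hD.map _).map _

theorem isSimpleGroup_of_isMinimalNormal {X : Type*} [Group X] [Finite X] {p : ℕ}
    (hp : p.Prime)
    (hrank : ∀ a b : X, a ^ p = 1 → b ^ p = 1 → a ≠ 1 → Commute a b → b ∈ Subgroup.zpowers a)
    {T : Subgroup X} [T.Normal] (hbot : T ≠ ⊥)
    (hmin : ∀ M : Subgroup X, M.Normal → M ≤ T → M = ⊥ ∨ M = T) (hpT : p ∣ Nat.card T) :
    IsSimpleGroup T := by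
  have := Fact.mk hp
  have hdvd : ∀ D : Subgroup T, D.Normal → D ≠ ⊥ → p ∣ Nat.card D := by
    intro D hDn hD
    by_contra hpD
    obtain ⟨m, n, hn, hmn⟩ := Nat.exists_eq_pow_mul_and_not_dvd
      (Nat.card_pos (α := T)).ne' p hp.ne_one
    have hDP : IsPGroup n D := by
      refine IsPGroup.of_card_dvd_pow (n := 1) ?_
      rw [pow_one]
      have h1 := D.card_subgroup_dvd_card
      rw [hmn] at h1
      exact ((hp.coprime_iff_not_dvd.mpr hpD).symm.pow_right m).dvd_of_dvd_mul_left h1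
    obtain ⟨N, hN, hNT, hDN, hNP⟩ := exists_normal_isPGroup D hDP
    rcases hmin N hN hNT with rfl | rfl
    · rw [le_bot_iff, Subgroup.map_eq_bot_iff_of_injective _ T.subtype_injective] at hDN
      exact hD hDN
    · obtain ⟨t, ht⟩ := exists_prime_orderOf_dvd_card' p hpT
      obtain ⟨k, hk⟩ := isPGroup_iff_orderOf_dvd_pow.mp hNP t
      rw [ht] at hk
      exact hn (hp.dvd_of_dvd_pow hk)
  have hinf : ∀ D E : Subgroup T, D.Normal → E.Normal → D ≠ ⊥ → E ≠ ⊥ → D ⊓ E ≠ ⊥ := by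
    intro D E hDn hEn hD hE hDE
    obtain ⟨a, ha⟩ := exists_prime_orderOf_dvd_card' p (hdvd D hDn hD)
    obtain ⟨b, hb⟩ := exists_prime_orderOf_dvd_card' p (hdvd E hEn hE)
    have hcomm : Commute (a : T) b :=
      Subgroup.commute_of_normal_of_disjoint D E hDn hEn (disjoint_iff.mpr hDE) a b a.2 b.2
    have ha1 : a ≠ 1 := by
      rintro rfl
      exact hp.one_lt.ne (by simpa using ha)
    have hb1 : b ≠ 1 := by
      rintro rfl
      exact hp.one_lt.ne (by simpa using hb)
    obtain ⟨k, hk⟩ := hrank (a : T) (b : T) (by exact_mod_cast ha ▸ pow_orderOf_eq_one a)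
      (by exact_mod_cast hb ▸ pow_orderOf_eq_one b) (by exact_mod_cast ha1)
      (by exact_mod_cast congrArg (T.subtype) hcomm.eq)
    have hbD : (b : T) ∈ D := by
      have : (b : T) = (a : T) ^ k := Subtype.ext (by simpa using hk.symm)
      rw [this]
      exact D.zpow_mem a.2 k
    have : (b : T) ∈ D ⊓ E := ⟨hbD, b.2⟩
    rw [hDE, Subgroup.mem_bot] at this
    exact hb1 (by exact_mod_cast this)
  have hnt : Nontrivial T := (Subgroup.nontrivial_iff_ne_bot T).mpr hbot
  obtain ⟨D, ⟨hDn, hD⟩, hDmin⟩ := Set.Finite.exists_minimal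
    (Set.toFinite {D : Subgroup T | D.Normal ∧ D ≠ ⊥}) ⟨⊤, inferInstance, top_ne_bot⟩
  have hle : ∀ E : Subgroup T, E.Normal → E ≠ ⊥ → D ≤ E := by
    intro E hEn hE
    exact (hDmin ⟨inferInstance, hinf D E hDn hEn hD hE⟩ inf_le_left).trans inf_le_right
  have hDX : (D.map T.subtype).Normal := by
    refine ⟨?_⟩
    rintro _ ⟨t, ht, rfl⟩ g
    have h := hle (D.comap (MulAut.conjNormal g : MulAut T).toMonoidHom) (hDn.comap _) ?_ ht
    · exact ⟨_, h, by simp⟩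
    · intro h
      apply hD
      refine Subgroup.comap_injective (MulAut.conjNormal g : MulAut T).surjective ?_
      exact h.trans (MonoidHom.ker_eq_bot _ (MulAut.conjNormal g : MulAut T).injective).symm
  have hDtop : D = ⊤ := by
    rcases hmin _ hDX (Subgroup.map_subtype_le D) with h | h
    · exact absurd ((Subgroup.map_eq_bot_iff_of_injective _ T.subtype_injective).mp h) hD
    · apply Subgroup.map_injective T.subtype_injective
      rw [h, ← MonoidHom.range_eq_map, Subgroup.range_subtype]
  exact ⟨fun E hE => or_iff_not_imp_left.mpr fun h => top_le_iff.mp (hDtop ▸ hle E hE h)⟩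

/-- An element of the image of `f` has a preimage whose order involves no new primes. -/
theorem exists_map_eq_and_prime_dvd_orderOf {G H : Type*} [Group G] [Finite G] [Group H]
    (f : G →* H) (g : G) :
    ∃ g' : G, f g' = f g ∧ ∀ r : ℕ, r.Prime → r ∣ orderOf g' → r ∣ orderOf (f g) := by
  induction hn : orderOf g using Nat.strong_induction_on generalizing g with
  | _ n ih =>
    by_cases h : ∀ r : ℕ, r.Prime → r ∣ orderOf g → r ∣ orderOf (f g)
    · exact ⟨g, rfl, h⟩
    push Not at h
    obtain ⟨r, hr, hrg, hrf⟩ := h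
    obtain ⟨t, ht⟩ := exists_pow_eq_self_of_coprime (x := f g) ((hr.coprime_iff_not_dvd).mpr hrf)
    have hlt : orderOf ((g ^ r) ^ t) < n := by
      refine lt_of_le_of_lt (Nat.le_of_dvd (orderOf_pos _) (orderOf_pow_dvd t)) ?_
      rw [orderOf_pow' g hr.ne_zero, Nat.gcd_eq_right hrg, hn]
      exact Nat.div_lt_self (hn ▸ orderOf_pos g) hr.one_lt
    have hf : f ((g ^ r) ^ t) = f g := by rw [map_pow, map_pow, ht]
    obtain ⟨g', h1, h2⟩ := ih _ hlt _ rfl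
    rw [hf] at h1 h2
    exact ⟨g', h1, h2⟩

theorem OmegaBad.symm {p q : ℕ} {G : Type*} [Group G] (h : OmegaBad p q G) : OmegaBad q p G := by
  refine ⟨?_, fun g hg => h.2 g ⟨mul_comm q p ▸ hg.1, fun r hr hrg => (hg.2 r hr hrg).symm⟩⟩
  rw [mul_comm]
  exact h.1

theorem OmegaBad.quotient {p q : ℕ} {G : Type*} [Group G] [Finite G] (h : OmegaBad p q G)
    (N : Subgroup G) [N.Normal] (hN : ∃ g : G ⧸ N, p * q ∣ orderOf g) : OmegaBad p q (G ⧸ N) := by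
  refine ⟨hN, fun x hx => ?_⟩
  obtain ⟨g, rfl⟩ := QuotientGroup.mk'_surjective N x
  obtain ⟨g', hg', hr⟩ := exists_map_eq_and_prime_dvd_orderOf (QuotientGroup.mk' N) g
  rw [← hg'] at hx ⊢
  refine frattini_le_comap_frattini_of_surjective (QuotientGroup.mk'_surjective N)
    (h.2 g' ⟨hx.1.trans (orderOf_map_dvd _ _), fun r hrp hrg => hx.2 r hrp ?_⟩)
  rw [hg']
  exact hr r hrp hrg

theorem OmegaBad.eq_bot_of_dvd_orderOf.{u} {p q : ℕ} {G : Type u} [Group G] [Finite G]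
    (h : OmegaBad p q G)
    (hmin : ∀ (H : Type u) [Group H] [Finite H], OmegaBad p q H → Nat.card G ≤ Nat.card H)
    (N : Subgroup G) [N.Normal] {g : G ⧸ N} (hg : p * q ∣ orderOf g) : N = ⊥ := by
  have h1 := hmin _ (h.quotient N ⟨g, hg⟩)
  rw [N.card_eq_card_quotient_mul_card_subgroup] at h1
  have h2 : 0 < Nat.card (G ⧸ N) := Nat.card_pos
  have h3 : 0 < Nat.card N := Nat.card_pos
  exact Subgroup.card_eq_one.mp (by nlinarith)

theorem OmegaBad.dvd_card_frattini {p q : ℕ} {G : Type*} [Group G] [Finite G] (hp : p.Prime)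
    (hq : q.Prime) (h : OmegaBad p q G) : p * q ∣ Nat.card (frattini G) := by
  obtain ⟨g, hg⟩ := h.1
  have ho : orderOf (g ^ (orderOf g / (p * q))) = p * q := orderOf_pow_orderOf_div
    (orderOf_pos g).ne' hg
  refine ho ▸ Subgroup.orderOf_dvd_natCard _ (h.2 _ ⟨ho.symm.dvd, fun r hr hrg => ?_⟩)
  rw [ho] at hrg
  exact (hr.dvd_mul.mp hrg).imp (Nat.prime_dvd_prime_iff_eq hr hp).mp
    (Nat.prime_dvd_prime_iff_eq hr hq).mp

theorem OmegaBad.eq_bot_or_le_or_le.{u} {p q : ℕ} {G : Type u} [Group G] [Finite G] (hp : p.Prime)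
    (hq : q.Prime) (hpq : p ≠ q) (h : OmegaBad p q G)
    (hmin : ∀ (H : Type u) [Group H] [Finite H], OmegaBad p q H → Nat.card G ≤ Nat.card H)
    {P Q : Subgroup G} [hPn : P.Normal] [hQn : Q.Normal] (hP : IsPGroup p P) (hQ : IsPGroup q Q)
    (N : Subgroup G) [N.Normal] : N = ⊥ ∨ P ≤ N ∨ Q ≤ N := by
  have := Fact.mk hp
  have := Fact.mk hq
  rw [or_iff_not_imp_right, not_or, SetLike.not_le_iff_exists, SetLike.not_le_iff_exists]
  rintro ⟨⟨x, hx, hxN⟩, ⟨y, hy, hyN⟩⟩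
  have hxy : Commute x y := Subgroup.commute_of_normal_of_disjoint P Q hPn hQn
    (IsPGroup.disjoint_of_ne p q hpq P Q hP hQ) x y hx hy
  have key : ∀ {r : ℕ} {R : Subgroup G} {z : G}, r.Prime → IsPGroup r R → z ∈ R → z ∉ N →
      ∃ k, orderOf (z : G ⧸ N) = r ^ (k + 1) := by
    intro r R z hr hR hz hzN
    obtain ⟨k, hk⟩ := isPGroup_iff_orderOf_dvd_pow.mp hR ⟨z, hz⟩
    rw [Subgroup.orderOf_mk] at hk
    obtain ⟨j, _, hj⟩ := (Nat.dvd_prime_pow hr).mp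
      ((orderOf_map_dvd (QuotientGroup.mk' N) z).trans hk)
    cases j with
    | zero =>
      rw [pow_zero, orderOf_eq_one_iff] at hj
      exact absurd ((QuotientGroup.eq_one_iff z).mp hj) hzN
    | succ j => exact ⟨j, hj⟩
  obtain ⟨j, hj⟩ := key hp hP hx hxN
  obtain ⟨k, hk⟩ := key hq hQ hy hyN
  refine h.eq_bot_of_dvd_orderOf hmin N (g := (x : G ⧸ N) * y) ?_
  rw [Commute.orderOf_mul_eq_mul_orderOf_of_coprime (x := (x : G ⧸ N)) (y := (y : G ⧸ N))
    (hxy.map (QuotientGroup.mk' N))]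
  · rw [hj, hk]
    exact mul_dvd_mul (dvd_pow_self p j.succ_ne_zero) (dvd_pow_self q k.succ_ne_zero)
  · rw [hj, hk]
    exact Nat.Coprime.pow _ _ ((Nat.coprime_primes hp hq).mpr hpq)

theorem isMulCommutative_of_eq_bot_or_le_or_le {p q : ℕ} {G : Type*} [Group G] [Finite G]
    (hp : p.Prime) (hq : q.Prime) (hpq : p ≠ q) {P Q : Subgroup G} [Q.Normal]
    (hP : IsPGroup p P) (hQ : IsPGroup q Q) (hP1 : P ≠ ⊥) (hQ1 : Q ≠ ⊥)
    (h : ∀ N : Subgroup G, N.Normal → N = ⊥ ∨ P ≤ N ∨ Q ≤ N) : IsMulCommutative Q := by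
  have := Fact.mk hp
  have := Fact.mk hq
  have hdisj := IsPGroup.disjoint_of_ne p q hpq P Q hP hQ
  rcases h ⁅Q, Q⁆ inferInstance with h | h | h
  · rw [Subgroup.commutator_eq_bot_iff_le_centralizer] at h
    exact ⟨⟨fun a b => Subtype.ext (Subgroup.mem_centralizer_iff.mp (h b.2) a a.2)⟩⟩
  · exact absurd (hdisj le_rfl (h.trans (Subgroup.commutator_le_left Q Q))) (by simpa using hP1)
  · exfalso
    have := hQ.isNilpotent
    have hnt : Nontrivial Q := (Subgroup.nontrivial_iff_ne_bot Q).mpr hQ1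
    have h1 := Group.IsSolvable.commutator_lt_of_ne_bot (top_ne_bot (α := Subgroup Q))
    apply h1.not_ge
    rw [← Subgroup.map_le_map_iff_of_injective Q.subtype_injective, Subgroup.map_commutator,
      ← MonoidHom.range_eq_map, Subgroup.range_subtype]
    exact h

theorem Sylow.le_center_of_isNilpotent {F : Type*} [Group F] [Finite F] [Group.IsNilpotent F]
    {q : ℕ} [hq : Fact q.Prime] (Q : Sylow q F) [hQ : IsMulCommutative Q] :
    (Q : Subgroup F) ≤ Subgroup.center F := by
  have hnorm : ∀ (r : ℕ) [Fact r.Prime] (R : Sylow r F), (R : Subgroup F).Normal := fun r _ R =>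
    R.normal_of_normalizerCondition Group.normalizerCondition_of_isNilpotent
  rw [← SetLike.coe_subset_coe, ← Subgroup.centralizer_eq_top_iff_subset, ← Subgroup.index_eq_one]
  by_contra hne
  obtain ⟨r, hr, hrdvd⟩ := Nat.exists_prime_and_dvd hne
  have := Fact.mk hr
  obtain ⟨R⟩ : Nonempty (Sylow r F) := inferInstance
  have hR : (R : Subgroup F) ≤ Subgroup.centralizer (Q : Set F) := by
    by_cases hrq : r = q
    · subst hrq
      have : R = Q := by
        have := hnorm r Q
        have := Q.unique_of_normal this
        exact Subsingleton.elim _ _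
      subst this
      exact Subgroup.le_centralizer _
    · intro x hx
      rw [Subgroup.mem_centralizer_iff]
      intro y hy
      exact Subgroup.commute_of_normal_of_disjoint _ _ (hnorm q Q) (hnorm r R)
        (IsPGroup.disjoint_of_ne q r (Ne.symm hrq) _ _ Q.2 R.2) y x hy hx
  exact R.not_dvd_index (hrdvd.trans (Subgroup.index_dvd_of_le hR))

/-- The configuration inside a minimal `OmegaBad` group `G`: `P` and `Q` are the Sylow `p`- and
`q`-subgroups of the Frattini subgroup of `G`. -/
structure IsCriticalPair (p q : ℕ) {G : Type*} [Group G] (P Q : Subgroup G) : Prop where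
  bad : OmegaBad p q G
  normal_left : P.Normal
  normal_right : Q.Normal
  isPGroup_left : IsPGroup p P
  isPGroup_right : IsPGroup q Q
  ne_bot_left : P ≠ ⊥
  ne_bot_right : Q ≠ ⊥
  le_left : P ≤ frattini G
  le_right : Q ≤ frattini G
  le_centralizer_left : frattini G ≤ Subgroup.centralizer P
  le_centralizer_right : frattini G ≤ Subgroup.centralizer Q
  not_dvd_left : ¬ p ∣ P.relIndex (frattini G)
  not_dvd_right : ¬ q ∣ Q.relIndex (frattini G)
  eq_bot_or_le_or_le : ∀ N : Subgroup G, N.Normal → N = ⊥ ∨ P ≤ N ∨ Q ≤ N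

theorem OmegaBad.exists_isCriticalPair.{u} {p q : ℕ} {G : Type u} [Group G] [Finite G]
    (hp : p.Prime) (hq : q.Prime) (hpq : p ≠ q) (h : OmegaBad p q G)
    (hmin : ∀ (H : Type u) [Group H] [Finite H], OmegaBad p q H → Nat.card G ≤ Nat.card H) :
    ∃ P Q : Subgroup G, IsCriticalPair p q P Q := by
  have hnil : Group.IsNilpotent (frattini G) := frattini_nilpotent
  have hnorm : ∀ (r : ℕ) [Fact r.Prime] (R : Sylow r (frattini G)),
      ((R : Subgroup (frattini G)).map (frattini G).subtype).Normal := by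
    intro r _ R
    have := R.characteristic_of_normal
      (R.normal_of_normalizerCondition Group.normalizerCondition_of_isNilpotent)
    exact ConjAct.normal_of_characteristic_of_normal
  have hne : ∀ (r : ℕ) [Fact r.Prime] (R : Sylow r (frattini G)), r ∣ Nat.card (frattini G) →
      (R : Subgroup (frattini G)).map (frattini G).subtype ≠ ⊥ := by
    intro r _ R hr
    rw [Ne, Subgroup.map_eq_bot_iff_of_injective _ (frattini G).subtype_injective]
    exact R.ne_bot_of_dvd_card hr
  have hcent : ∀ (r : ℕ) [Fact r.Prime] (R : Sylow r (frattini G)),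
      IsMulCommutative ((R : Subgroup (frattini G)).map (frattini G).subtype) →
      frattini G ≤
        Subgroup.centralizer ((R : Subgroup (frattini G)).map (frattini G).subtype) := by
    rintro r _ R hR x hx
    have : IsMulCommutative R := ⟨⟨fun a b => by
      have := congrArg Subtype.val (hR.is_comm.comm ⟨_, a.1, a.2, rfl⟩ ⟨_, b.1, b.2, rfl⟩)
      exact Subtype.ext (Subtype.ext this)⟩⟩
    rw [Subgroup.mem_centralizer_iff]
    rintro _ ⟨y, hy, rfl⟩
    exact congrArg Subtype.val
      (Subgroup.mem_center_iff.mp (R.le_center_of_isNilpotent hy) ⟨x, hx⟩).symm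
  have hrel : ∀ (r : ℕ) [Fact r.Prime] (R : Sylow r (frattini G)),
      ¬ r ∣ ((R : Subgroup (frattini G)).map (frattini G).subtype).relIndex (frattini G) := by
    intro r _ R
    have : ((R : Subgroup (frattini G)).map (frattini G).subtype).subgroupOf (frattini G) = R :=
      Subgroup.comap_map_eq_self_of_injective (frattini G).subtype_injective _
    rw [Subgroup.relIndex, this]
    exact R.not_dvd_index
  have := Fact.mk hp
  have := Fact.mk hq
  obtain ⟨P⟩ : Nonempty (Sylow p (frattini G)) := inferInstance
  obtain ⟨Q⟩ : Nonempty (Sylow q (frattini G)) := inferInstance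
  have hPn := hnorm p P
  have hQn := hnorm q Q
  have hPp := P.2.map (frattini G).subtype
  have hQq := Q.2.map (frattini G).subtype
  have hP1 := hne p P ((dvd_mul_right p q).trans (h.dvd_card_frattini hp hq))
  have hQ1 := hne q Q ((dvd_mul_left q p).trans (h.dvd_card_frattini hp hq))
  have htri := fun (N : Subgroup G) (_ : N.Normal) =>
    h.eq_bot_or_le_or_le hp hq hpq hmin hPp hQq N
  exact ⟨_, _, {
    bad := h
    normal_left := hPn
    normal_right := hQn
    isPGroup_left := hPp
    isPGroup_right := hQq
    ne_bot_left := hP1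
    ne_bot_right := hQ1
    le_left := Subgroup.map_subtype_le _
    le_right := Subgroup.map_subtype_le _
    le_centralizer_left := hcent p P <| isMulCommutative_of_eq_bot_or_le_or_le hq hp hpq.symm
      hQq hPp hQ1 hP1 fun N hN => (htri N hN).imp_right Or.symm
    le_centralizer_right := hcent q Q <| isMulCommutative_of_eq_bot_or_le_or_le hp hq hpq
      hPp hQq hP1 hQ1 htri
    not_dvd_left := hrel p P
    not_dvd_right := hrel q Q
    eq_bot_or_le_or_le := htri }⟩

namespace IsCriticalPair

variable {p q : ℕ} {G : Type*} [Group G] {P Q : Subgroup G}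

theorem symm (h : IsCriticalPair p q P Q) : IsCriticalPair q p Q P where
  bad := h.bad.symm
  normal_left := h.normal_right
  normal_right := h.normal_left
  isPGroup_left := h.isPGroup_right
  isPGroup_right := h.isPGroup_left
  ne_bot_left := h.ne_bot_right
  ne_bot_right := h.ne_bot_left
  le_left := h.le_right
  le_right := h.le_left
  le_centralizer_left := h.le_centralizer_right
  le_centralizer_right := h.le_centralizer_left
  not_dvd_left := h.not_dvd_right
  not_dvd_right := h.not_dvd_left
  eq_bot_or_le_or_le N hN := (h.eq_bot_or_le_or_le N hN).imp_right Or.symm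

theorem isMulCommutative_right (h : IsCriticalPair p q P Q) : IsMulCommutative Q :=
  ⟨⟨fun a b => Subtype.ext
    (Subgroup.mem_centralizer_iff.mp (h.le_centralizer_right (h.le_right b.2)) a a.2)⟩⟩

theorem eq_one_of_commute [Finite G] (h : IsCriticalPair p q P Q) (hq : q.Prime) (hpq : p ≠ q)
    {x y : G} (hx : ∀ r : ℕ, r.Prime → r ∣ orderOf x → r = p) (hxF : x ∉ frattini G)
    (hy : y ∈ Q) (hxy : Commute x y) : y = 1 := by
  by_contra hy1
  have hxp : p ∣ orderOf x := by
    obtain ⟨r, hr, hrx⟩ := Nat.exists_prime_and_dvd (n := orderOf x) fun h1 =>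
      hxF (orderOf_eq_one_iff.mp h1 ▸ one_mem _)
    exact hx r hr hrx ▸ hrx
  obtain ⟨k, hk⟩ := isPGroup_iff_orderOf_dvd_pow.mp h.isPGroup_right ⟨y, hy⟩
  rw [Subgroup.orderOf_mk] at hk
  have hyr : ∀ r : ℕ, r.Prime → r ∣ orderOf y → r = q := fun r hr hry =>
    (Nat.prime_dvd_prime_iff_eq hr hq).mp (hr.dvd_of_dvd_pow (hry.trans hk))
  have hyq : q ∣ orderOf y := by
    obtain ⟨r, hr, hry⟩ := Nat.exists_prime_and_dvd (n := orderOf y) fun h1 =>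
      hy1 (orderOf_eq_one_iff.mp h1)
    exact hyr r hr hry ▸ hry
  have hcop : Nat.Coprime (orderOf x) (orderOf y) := Nat.coprime_of_dvd fun r hr hrx hry =>
    hpq ((hx r hr hrx).symm.trans (hyr r hr hry))
  have hmem : x * y ∈ frattini G := by
    refine h.bad.2 _ ?_
    rw [hxy.orderOf_mul_eq_mul_orderOf_of_coprime hcop]
    exact ⟨mul_dvd_mul hxp hyq, fun r hr hrd => (hr.dvd_mul.mp hrd).imp (hx r hr) (hyr r hr)⟩
  exact hxF (((frattini G).mul_mem_cancel_right (h.le_right hy)).mp hmem)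

theorem mem_zpowers [Finite G] (h : IsCriticalPair p q P Q) (hp : p.Prime) (hq : q.Prime)
    (hpq : p ≠ q) {a b : G ⧸ frattini G} (ha : a ^ p = 1) (hb : b ^ p = 1) (ha1 : a ≠ 1)
    (hab : Commute a b) : b ∈ Subgroup.zpowers a := by
  have := h.normal_right
  let _ : CommGroup Q :=
    { (inferInstance : Group Q) with mul_comm := h.isMulCommutative_right.is_comm.comm }
  let ρ : G ⧸ frattini G →* MulAut Q := QuotientGroup.lift (frattini G) MulAut.conjNormal <| by
    intro x hx
    ext v
    have := Subgroup.mem_centralizer_iff.mp (h.le_centralizer_right hx) v v.2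
    rw [MulAut.conjNormal_apply, ← this, mul_inv_cancel_right]
    rfl
  have hfree : ∀ x : G ⧸ frattini G, x ^ p = 1 → x ≠ 1 → ∀ v : Q, ρ x v = v → v = 1 := by
    intro x hxp hx1 v hv
    obtain ⟨g, rfl⟩ := QuotientGroup.mk'_surjective (frattini G) x
    obtain ⟨g', hg', hr⟩ := exists_map_eq_and_prime_dvd_orderOf (QuotientGroup.mk' (frattini G)) g
    rw [← hg'] at hxp hx1 hv hr
    have hv' : g' * v * g'⁻¹ = v := by
      rw [← MulAut.conjNormal_apply]
      exact congrArg Subtype.val hv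
    refine Subtype.ext (h.eq_one_of_commute hq hpq (x := g') (fun r hrp hrg => ?_) (fun hF => ?_)
      v.2 (mul_inv_eq_iff_eq_mul.mp hv'))
    · exact (Nat.prime_dvd_prime_iff_eq hrp hp).mp
        ((hr r hrp hrg).trans (orderOf_dvd_of_pow_eq_one hxp))
    · exact hx1 ((QuotientGroup.eq_one_iff g').mpr hF)
  by_contra hba
  have hpow : ∀ v : Q, v ^ p = 1 := pow_eq_one_of_fixedPointFree (V := Q) ρ hp hab ha hb
    (hfree a ha ha1) fun i => hfree _
      (by rw [(hab.symm.pow_right i).mul_pow, hb, ← pow_mul, mul_comm i, pow_mul, ha, one_pow,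
        one_mul])
      (fun h1 => hba (by
        rw [eq_inv_of_mul_eq_one_left h1]
        exact inv_mem (pow_mem (Subgroup.mem_zpowers a) i)))
  have hnt : Nontrivial Q := (Subgroup.nontrivial_iff_ne_bot Q).mpr h.ne_bot_right
  obtain ⟨v, hv⟩ := exists_ne (1 : Q)
  obtain ⟨k, hk⟩ := isPGroup_iff_orderOf_dvd_pow.mp h.isPGroup_right v
  refine hv (orderOf_eq_one_iff.mp (Nat.eq_one_of_dvd_coprimes ?_
    (orderOf_dvd_of_pow_eq_one (hpow v)) hk))
  exact ((Nat.coprime_primes hp hq).mpr hpq).pow_right k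

theorem exists_normal_complement [Finite G] (h : IsCriticalPair p q P Q) (hq : q.Prime)
    {M : Subgroup G} [M.Normal] (hM : frattini G ≤ M) (hqM : ¬ q ∣ (frattini G).relIndex M) :
    ∃ L : Subgroup G, L.Normal ∧ L ≤ M ∧ Nat.card L = Q.relIndex M ∧ ¬ q ∣ Nat.card L := by
  have := Fact.mk hq
  have := h.normal_right
  have := h.isMulCommutative_right
  have hndvd : ¬ q ∣ Q.relIndex M := by
    rw [← Subgroup.relIndex_mul_relIndex Q _ M h.le_right hM, hq.dvd_mul]
    exact not_or.mpr ⟨h.not_dvd_right, hqM⟩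
  obtain ⟨k, hk⟩ := h.isPGroup_right.exists_card_eq
  obtain ⟨L, hL, hLM, hLc⟩ := exists_normal_complement_of_le_frattini (h.le_right.trans hM)
    h.le_right (hk ▸ Nat.Coprime.pow_left k (hq.coprime_iff_not_dvd.mpr hndvd))
  exact ⟨L, hL, hLM, hLc, hLc ▸ hndvd⟩

theorem dvd_card_right [Finite G] (h : IsCriticalPair p q P Q) (hq : q.Prime) :
    q ∣ Nat.card Q := by
  have := Fact.mk hq
  obtain ⟨k, hk⟩ := h.isPGroup_right.exists_card_eq
  rw [hk]
  refine dvd_pow_self q ?_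
  rintro rfl
  exact h.ne_bot_right (Subgroup.card_eq_one.mp (by simpa using hk))

theorem not_dvd_relIndex_left [Finite G] (h : IsCriticalPair p q P Q) (hp : p.Prime)
    (hq : q.Prime) (hpq : p ≠ q) {M : Subgroup G} [M.Normal] (hM : frattini G ≤ M)
    (hqM : ¬ q ∣ (frattini G).relIndex M) : ¬ p ∣ (frattini G).relIndex M := by
  intro hpM
  have := Fact.mk hp
  have := Fact.mk hq
  obtain ⟨L, hL, hLM, hLc, hqL⟩ := h.exists_normal_complement hq hM hqM
  have hdisj : Disjoint L Q := by
    obtain ⟨k, hk⟩ := h.isPGroup_right.exists_card_eq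
    exact Subgroup.disjoint_of_coprime_natCard
      (hk ▸ (Nat.Coprime.pow_left k (hq.coprime_iff_not_dvd.mpr hqL)).symm)
  have hdvd : p ∣ (frattini G).relIndex L := by
    refine hpM.trans ?_
    have h1 : Nat.card ((frattini G).subgroupOf L) * (frattini G).relIndex L = Nat.card L :=
      Subgroup.card_mul_index _
    rw [hLc, ← Subgroup.relIndex_mul_relIndex Q _ M h.le_right hM] at h1
    have h2 : Nat.card ((frattini G).subgroupOf L) = Nat.card (L ⊓ frattini G : Subgroup G) := by
      rw [← Subgroup.inf_subgroupOf_left]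
      exact Nat.card_congr (Subgroup.subgroupOfEquivOfLe inf_le_left).toEquiv
    have h3 : Nat.card (L ⊓ frattini G : Subgroup G) ∣ Q.relIndex (frattini G) := by
      have h4 := Subgroup.card_dvd_of_le (inf_le_right : L ⊓ frattini G ≤ frattini G)
      rw [← Subgroup.card_mul_index (Q.subgroupOf (frattini G))] at h4
      refine Nat.Coprime.dvd_of_dvd_mul_left ?_ h4
      rw [Nat.card_congr (Subgroup.subgroupOfEquivOfLe h.le_right).toEquiv]
      obtain ⟨k, hk⟩ := h.isPGroup_right.exists_card_eq
      rw [hk]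
      exact (Nat.Coprime.pow_left k (hq.coprime_iff_not_dvd.mpr fun hd =>
        hqL (hd.trans (Subgroup.card_dvd_of_le inf_le_left)))).symm
    obtain ⟨e, he⟩ := h3
    rw [h2, he, mul_assoc] at h1
    exact ⟨e, (Nat.eq_of_mul_eq_mul_left Nat.card_pos h1).trans (mul_comm _ _)⟩
  obtain ⟨x, hx⟩ := exists_prime_orderOf_dvd_card' (G := L ⧸ (frattini G).subgroupOf L) p hdvd
  obtain ⟨l, rfl⟩ := QuotientGroup.mk'_surjective _ x
  obtain ⟨l', hl', hr⟩ := exists_map_eq_and_prime_dvd_orderOf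
    (QuotientGroup.mk' ((frattini G).subgroupOf L)) l
  obtain ⟨y, hy, hy1⟩ := Q.bot_or_exists_ne_one.resolve_left h.ne_bot_right
  refine hy1 (h.eq_one_of_commute hq hpq (x := (l' : G)) (fun r hrp hrl => ?_) (fun hF => ?_) hy
    (Subgroup.commute_of_normal_of_disjoint L Q hL h.normal_right hdisj _ _ l'.2 hy))
  · rw [Subgroup.orderOf_coe] at hrl
    exact (Nat.prime_dvd_prime_iff_eq hrp hp).mp (hx ▸ hr r hrp hrl)
  · have h1 : QuotientGroup.mk' ((frattini G).subgroupOf L) l' = 1 :=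
      (QuotientGroup.eq_one_iff l').mpr hF
    rw [← hl', h1, orderOf_one] at hx
    exact hp.one_lt.ne hx

theorem dvd_relIndex [Finite G] (h : IsCriticalPair p q P Q) (hp : p.Prime)
    (hq : q.Prime) (hpq : p ≠ q) {M : Subgroup G} [M.Normal] (hM : frattini G < M) :
    q ∣ (frattini G).relIndex M := by
  by_contra hqM
  have := Fact.mk hp
  have := Fact.mk hq
  have hmul : ∀ {A B C : Subgroup G}, Disjoint A B → A ≤ C → B ≤ C →
      Nat.card A * Nat.card B ≤ Nat.card C := by
    intro A B C hAB hA hB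
    rw [← Nat.card_prod]
    refine Nat.card_le_card_of_injective
      (fun x : A × B => (⟨x.1 * x.2, C.mul_mem (hA x.1.2) (hB x.2.2)⟩ : C)) fun x y hxy => ?_
    exact Subgroup.mul_injective_of_disjoint hAB (congrArg Subtype.val hxy)
  have hcard : ∀ {A : Subgroup G}, A ≤ M → Nat.card A * A.relIndex M = Nat.card M := by
    intro A hA
    rw [← Nat.card_congr (Subgroup.subgroupOfEquivOfLe hA).toEquiv]
    exact Subgroup.card_mul_index _
  obtain ⟨L, hL, hLM, hLc, hqL⟩ := h.exists_normal_complement hq hM.le hqM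
  obtain ⟨K, hK, hKM, hKc, hpK⟩ := h.symm.exists_normal_complement hp hM.le
    (h.not_dvd_relIndex_left hp hq hpq hM.le hqM)
  have hLK : L ⊓ K = ⊥ := by
    rcases h.eq_bot_or_le_or_le (L ⊓ K) inferInstance with hb | hb | hb
    · exact hb
    · exact absurd ((h.symm.dvd_card_right hp).trans
        (Subgroup.card_dvd_of_le (hb.trans inf_le_right))) hpK
    · exact absurd ((h.dvd_card_right hq).trans
        (Subgroup.card_dvd_of_le (hb.trans inf_le_left))) hqL
  have h1 := hmul (disjoint_iff.mpr hLK) hLM hKM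
  have h2 := hmul (IsPGroup.disjoint_of_ne p q hpq P Q h.isPGroup_left h.isPGroup_right)
    h.le_left h.le_right
  have h3 := hcard (h.le_left.trans hM.le)
  have h4 := hcard (h.le_right.trans hM.le)
  rw [← hKc] at h3
  rw [← hLc] at h4
  have h5 : Nat.card M ≤ Nat.card P * Nat.card Q := by
    have hpos : 0 < Nat.card M := Nat.card_pos
    refine Nat.le_of_mul_le_mul_left ?_ hpos
    calc Nat.card M * Nat.card M = (Nat.card L * Nat.card K) * (Nat.card P * Nat.card Q) := by
          nth_rewrite 1 [← h3]
          rw [← h4]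
          ring
      _ ≤ Nat.card M * (Nat.card P * Nat.card Q) := Nat.mul_le_mul_right _ h1
  exact hM.ne (Subgroup.eq_of_le_of_card_ge hM.le (h5.trans h2))

theorem dvd_card [Finite G] (h : IsCriticalPair p q P Q) (hp : p.Prime)
    (hq : q.Prime) (hpq : p ≠ q) {T : Subgroup (G ⧸ frattini G)} [hT : T.Normal] (hT1 : T ≠ ⊥) :
    q ∣ Nat.card T := by
  let f := QuotientGroup.mk' (frattini G)
  have hf : Function.Surjective f := QuotientGroup.mk'_surjective _
  have hker : (⊥ : Subgroup (G ⧸ frattini G)).comap f = frattini G := QuotientGroup.ker_mk' _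
  have : (T.comap f).Normal := hT.comap f
  have hlt : frattini G < T.comap f := by
    have := (Subgroup.comap_lt_comap_of_surjective hf).mpr (bot_lt_iff_ne_bot.mpr hT1)
    rwa [hker] at this
  have hcard := Subgroup.relIndex_comap ⊥ f (T.comap f)
  rw [hker, Subgroup.map_comap_eq_self_of_surjective hf, Subgroup.relIndex_bot_left] at hcard
  exact hcard ▸ h.dvd_relIndex hp hq hpq hlt

theorem exists_sylow_le [Finite G] (h : IsCriticalPair p q P Q) (hp : p.Prime)
    (hq : q.Prime) (hpq : p ≠ q) (hpodd : Odd p) {T : Subgroup (G ⧸ frattini G)} [T.Normal]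
    [IsSimpleGroup T] (hT : ¬ ∀ a b : T, a * b = b * a) :
    ∃ A : Sylow p (G ⧸ frattini G), (A : Subgroup (G ⧸ frattini G)) ≤ T := by
  have := Fact.mk hp
  obtain ⟨A⟩ : Nonempty (Sylow p (G ⧸ frattini G)) := inferInstance
  have hT1 : T ≠ ⊥ := (Subgroup.nontrivial_iff_ne_bot T).mp inferInstance
  refine ⟨A, sylow_le_of_isSimpleGroup T hT (h.symm.dvd_card hq hp hpq.symm hT1) A
    (IsPGroup.isCyclic_of_odd hp hpodd A.2 fun a b ha hb ha1 hab => ?_)⟩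
  obtain ⟨k, hk⟩ := h.mem_zpowers hp hq hpq (a := (a : G ⧸ frattini G)) (b := b)
    (by exact_mod_cast congrArg Subtype.val ha) (by exact_mod_cast congrArg Subtype.val hb)
    (by exact_mod_cast ha1) (congrArg Subtype.val hab.eq)
  exact ⟨k, Subtype.ext (by simpa using hk)⟩

end IsCriticalPair

theorem eq_of_isMinimalNormal {X : Type*} [Group X] [Finite X] {p : ℕ} (hp : p.Prime)
    (hrank : ∀ a b : X, a ^ p = 1 → b ^ p = 1 → a ≠ 1 → Commute a b → b ∈ Subgroup.zpowers a)
    {S T : Subgroup X} (hS : IsMinimalNormal S) (hT : IsMinimalNormal T)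
    (hpS : p ∣ Nat.card S) (hpT : p ∣ Nat.card T) : S = T := by
  have := Fact.mk hp
  have hSn := hS.1
  have hTn := hT.1
  rcases hS.2.2 (S ⊓ T) inferInstance inf_le_left with h | h
  · exfalso
    obtain ⟨a, ha⟩ := exists_prime_orderOf_dvd_card' p hpS
    obtain ⟨b, hb⟩ := exists_prime_orderOf_dvd_card' p hpT
    rw [← Subgroup.orderOf_coe] at ha hb
    have hab := Subgroup.commute_of_normal_of_disjoint S T hSn hTn (disjoint_iff.mpr h) a b a.2 b.2
    have ha1 : (a : X) ≠ 1 := fun h1 => hp.one_lt.ne (by rw [← ha, h1, orderOf_one])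
    have hbS : (b : X) ∈ S := Subgroup.zpowers_le.mpr a.2 (hrank a b
      (ha ▸ pow_orderOf_eq_one _) (hb ▸ pow_orderOf_eq_one _) ha1 hab)
    have hb1 : (b : X) ∈ S ⊓ T := ⟨hbS, b.2⟩
    rw [h, Subgroup.mem_bot] at hb1
    exact hp.one_lt.ne (by rw [← hb, hb1, orderOf_one])
  · rcases hT.2.2 S hSn (inf_eq_left.mp h) with h' | h'
    · exact absurd h' hS.2.1
    · exact h'

theorem exists_isMinimalNormal (X : Type*) [Group X] [Finite X] [Nontrivial X] :
    ∃ T : Subgroup X, IsMinimalNormal T := by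
  obtain ⟨T, ⟨hTn, hT⟩, hTmin⟩ := Set.Finite.exists_minimal
    (Set.toFinite {D : Subgroup X | D.Normal ∧ D ≠ ⊥}) ⟨⊤, inferInstance, top_ne_bot⟩
  exact ⟨T, hTn, hT, fun M hM hMT => or_iff_not_imp_left.mpr fun h =>
    le_antisymm hMT (hTmin ⟨hM, h⟩ hMT)⟩

/-- Let `p, q` be distinct odd primes and `G` a finite group of minimal order subject to
`Ω_{p,q}(G) ≠ ∅` and `Ω**_{p,q}(G) = ∅`.  Set `X = G/Frat(G)` and `S = soc(X)`.  Then
`S` is a nonabelian simple group containing a Sylow `p`-subgroup and a Sylow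
`q`-subgroup of `X`. -/
theorem minimal_omegaBad_socle_simple.{u}
    (G : Type u) [Group G] [Finite G] (p q : ℕ)
    (hp : p.Prime) (hq : q.Prime) (hpodd : Odd p) (hqodd : Odd q) (hpq : p ≠ q)
    (hbad : OmegaBad p q G)
    (hmin : ∀ (H : Type u) [Group H] [Finite H], OmegaBad p q H → Nat.card G ≤ Nat.card H) :
    IsSimpleGroup (socle (G ⧸ frattini G)) ∧
      (¬ ∀ a b : socle (G ⧸ frattini G), a * b = b * a) ∧
      (∃ T : Sylow p (G ⧸ frattini G), (T : Subgroup (G ⧸ frattini G)) ≤ socle (G ⧸ frattini G)) ∧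
      (∃ T : Sylow q (G ⧸ frattini G), (T : Subgroup (G ⧸ frattini G)) ≤ socle (G ⧸ frattini G)) := by
  obtain ⟨P, Q, h⟩ := hbad.exists_isCriticalPair hp hq hpq hmin
  have hG : Nontrivial G := ⟨by
    obtain ⟨y, -, hy⟩ := Q.bot_or_exists_ne_one.resolve_left h.ne_bot_right
    exact ⟨y, 1, hy⟩⟩
  have hF : frattini G ≠ ⊤ := by
    intro hF
    have := frattini_nongenerating (K := (⊥ : Subgroup G)) (by rw [hF, bot_sup_eq])
    exact bot_ne_top this
  have hX : Nontrivial (G ⧸ frattini G) := QuotientGroup.nontrivial_iff.mpr hF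
  obtain ⟨T, hT⟩ := exists_isMinimalNormal (G ⧸ frattini G)
  have hrank := fun (a b : G ⧸ frattini G) (ha : a ^ p = 1) (hb : b ^ p = 1) (ha1 : a ≠ 1)
    (hab : Commute a b) => h.mem_zpowers hp hq hpq ha hb ha1 hab
  have hdvd : ∀ S : Subgroup (G ⧸ frattini G), IsMinimalNormal S → p ∣ Nat.card S := by
    intro S hS
    have := hS.1
    exact h.symm.dvd_card hq hp hpq.symm hS.2.1
  have hsoc : socle (G ⧸ frattini G) = T := by
    refine le_antisymm (iSup₂_le fun S hS => ?_) (le_iSup₂_of_le T hT le_rfl)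
    exact (eq_of_isMinimalNormal hp hrank hS hT (hdvd S hS) (hdvd T hT)).le
  rw [hsoc]
  have hTn := hT.1
  have hsimple := isSimpleGroup_of_isMinimalNormal hp hrank hT.2.1 hT.2.2 (hdvd T hT)
  have hcomm : ¬ ∀ a b : T, a * b = b * a := by
    intro hc
    let _ : CommGroup T := { (inferInstance : Group T) with mul_comm := hc }
    have hprime : (Nat.card T).Prime := IsSimpleGroup.prime_card
    exact hpq (((Nat.prime_dvd_prime_iff_eq hp hprime).mp (hdvd T hT)).trans
      ((Nat.prime_dvd_prime_iff_eq hq hprime).mp (h.dvd_card hp hq hpq hT.2.1)).symm)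
  exact ⟨hsimple, hcomm, h.exists_sylow_le hp hq hpq hpodd hcomm,
    h.symm.exists_sylow_le hq hp hpq.symm hqodd hcomm⟩
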